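/- arXiv:1109.4622 — 4 statements merged into one kernel-verified Lean document; each statement's English description precedes it below -/
import Mathlib

section
/- For a finite simple graph G on n vertices with m edges, the number of spanning trees t(G) satisfies t(G) ≤ n^{-1}·(2m/(n-1))^{n-1}. -/
/-- The number of spanning trees of a simple graph `G`: spanning subgraphs (on the same
vertex set) that are trees. -/
noncomputable def spanningTreeCount {V : Type*} (G : SimpleGraph V) : ℕ :=
  Set.ncard {T : SimpleGraph V | T ≤ G ∧ T.IsTree}

open Finset Matrix

/-- A square matrix whose off-diagonal nonzero entries strictly increase a height function has
determinant equal to the product of its diagonal entries. -/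
theorem Matrix.det_eq_prod_diag_of_height {V R : Type*} [Fintype V] [DecidableEq V] [CommRing R]
    (A : Matrix V V R) (b : V → ℕ) (h : ∀ i j, i ≠ j → b j ≤ b i → A i j = 0) :
    A.det = ∏ i, A i i := by
  rw [Matrix.det_apply', Finset.sum_eq_single 1]
  · simp
  · intro σ _ hσ
    by_cases hz : ∃ i, A (σ i) i = 0
    · obtain ⟨i, hi⟩ := hz
      exact mul_eq_zero_of_right _ (Finset.prod_eq_zero (mem_univ i) hi)
    · push Not at hz
      have hlt : ∀ i, σ i ≠ i → b (σ i) < b i := fun i hi => by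
        by_contra! hle
        exact hz i (h _ _ hi hle)
      obtain ⟨i, hi⟩ : ∃ i, σ i ≠ i := by
        by_contra! hid
        exact hσ (Equiv.ext hid)
      have hsum : ∑ i, b (σ i) < ∑ i, b i := by
        refine Finset.sum_lt_sum (fun j _ => ?_) ⟨i, mem_univ i, hlt i hi⟩
        by_cases hj : σ j = j
        · rw [hj]
        · exact (hlt j hj).le
      exact absurd (Equiv.sum_comp σ b) hsum.ne
  · simp

/-- A form of the Cauchy–Binet formula for Gram matrices, summing over all choices of columns. -/
theorem Matrix.sum_sq_det_submatrix {V κ R : Type*} [Fintype V] [DecidableEq V] [Fintype κ]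
    [CommRing R] (M : Matrix V κ R) :
    ∑ f : V → κ, (M.submatrix id f).det ^ 2 =
      ((Fintype.card V).factorial : R) * (M * Mᵀ).det := by
  classical
  have hdet : (M * Mᵀ).det = ∑ g : V → κ, (∏ i, M i (g i)) * (M.submatrix id g).det := by
    rw [Matrix.det_apply']
    simp only [Matrix.mul_apply, Finset.prod_univ_sum, Fintype.piFinset_univ, Finset.mul_sum,
      Matrix.transpose_apply]
    rw [Finset.sum_comm]
    simp only [Finset.prod_mul_distrib]
    refine Finset.sum_congr rfl fun g _ => ?_
    rw [Matrix.det_apply', Finset.mul_sum]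
    refine Finset.sum_congr rfl fun σ _ => ?_
    simp only [Matrix.submatrix_apply, id]
    ring
  have hσ : ∀ σ : Equiv.Perm V,
      ∑ f : V → κ, ((Equiv.Perm.sign σ : ℤ) : R) * (∏ i, M (σ i) (f i)) *
        (M.submatrix id f).det = (M * Mᵀ).det := by
    intro σ
    rw [hdet, ← Equiv.sum_comp (Equiv.arrowCongr σ.symm (Equiv.refl κ))]
    refine Finset.sum_congr rfl fun g _ => ?_
    have h1 : Equiv.arrowCongr σ.symm (Equiv.refl κ) g = g ∘ σ := by
      ext; simp
    have h2 : M.submatrix id (g ∘ σ) = (M.submatrix id g).submatrix id σ := rfl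
    have h3 : (((Equiv.Perm.sign σ : ℤ) : R)) * ((Equiv.Perm.sign σ : ℤ) : R) = 1 := by
      rw [← Int.cast_mul, ← Units.val_mul, Int.units_mul_self]; simp
    rw [h1, h2, Matrix.det_permute', ← Equiv.prod_comp σ (fun i => M i (g i))]
    simp only [Function.comp]
    linear_combination (∏ i, M (σ i) (g (σ i))) * (M.submatrix id g).det * h3
  calc ∑ f : V → κ, (M.submatrix id f).det ^ 2
      = ∑ f : V → κ, ∑ σ : Equiv.Perm V,
        ((Equiv.Perm.sign σ : ℤ) : R) * (∏ i, M (σ i) (f i)) * (M.submatrix id f).det := by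
        refine Finset.sum_congr rfl fun f _ => ?_
        rw [← Finset.sum_mul, pow_two]
        congr 1
        rw [Matrix.det_apply']
        rfl
    _ = ∑ σ : Equiv.Perm V, (M * Mᵀ).det := by
        rw [Finset.sum_comm]
        exact Finset.sum_congr rfl fun σ _ => hσ σ
    _ = _ := by
        rw [Finset.sum_const, Finset.card_univ, Fintype.card_perm, nsmul_eq_mul]

/-- The determinant of a positive semidefinite matrix is at most a power of its mean
eigenvalue. -/
theorem Matrix.PosSemidef.det_le_trace_div_card_pow {V : Type*} [Fintype V] [DecidableEq V]
    [Nonempty V] {A : Matrix V V ℝ} (hA : A.PosSemidef) :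
    A.det ≤ (A.trace / Fintype.card V) ^ Fintype.card V := by
  have hdet : A.det = ∏ i, hA.1.eigenvalues i := by
    simpa using hA.1.det_eq_prod_eigenvalues
  have htr : A.trace = ∑ i, hA.1.eigenvalues i := by
    simpa using hA.1.trace_eq_sum_eigenvalues
  have hnn := hA.eigenvalues_nonneg
  have hc : (0 : ℝ) < Fintype.card V := by exact_mod_cast Fintype.card_pos
  have key := Real.geom_mean_le_arith_mean univ (fun _ => 1) hA.1.eigenvalues
    (fun _ _ => zero_le_one) (by simpa using hc) (fun i _ => hnn i)
  simp only [Real.rpow_one, one_mul, Finset.sum_const, Finset.card_univ, nsmul_eq_mul,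
    mul_one] at key
  have hprod : 0 ≤ ∏ i, hA.1.eigenvalues i := Finset.prod_nonneg fun i _ => hnn i
  rw [hdet, htr]
  calc ∏ i, hA.1.eigenvalues i
      = ((∏ i, hA.1.eigenvalues i) ^ ((Fintype.card V : ℝ)⁻¹)) ^ Fintype.card V :=
        (Real.rpow_inv_natCast_pow hprod Fintype.card_ne_zero).symm
    _ ≤ _ := pow_le_pow_left₀ (Real.rpow_nonneg hprod _) key _

namespace SimpleGraph

variable {V : Type*}

/-- In a connected graph every vertex other than `r` has a neighbour closer to `r`. -/
theorem Connected.exists_adj_dist_lt {T : SimpleGraph V} (hT : T.Connected) (r : V) {v : V}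
    (hv : v ≠ r) : ∃ w, T.Adj v w ∧ T.dist r w < T.dist r v := by
  obtain ⟨p, hp⟩ := hT.exists_walk_length_eq_dist v r
  cases p with
  | nil => exact absurd rfl hv
  | cons h q =>
    refine ⟨_, h, ?_⟩
    have := T.dist_le q
    rw [Walk.length_cons] at hp
    rw [T.dist_comm (u := r), T.dist_comm (u := r)]
    omega

open Classical in
/-- The oriented incidence matrix of `G`, columns indexed by all unordered pairs (zero for
non-edges), with an extra column that is constantly `s`. -/
noncomputable def augIncMatrix (G : SimpleGraph V) (s : ℝ) : Matrix V (Option (Sym2 V)) ℝ :=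
  fun u k => match k with
  | none => s
  | some e => if e ∈ G.edgeSet then
      (if u = e.out.1 then 1 else 0) - (if u = e.out.2 then 1 else 0) else 0

/-- Up to sign, the column of the edge `vw` is the difference of the indicators of its ends. -/
theorem exists_sign_augIncMatrix [DecidableEq V] (G : SimpleGraph V) (s : ℝ) {v w : V}
    (h : G.Adj v w) :
    ∃ ε : ℝ, ε ^ 2 = 1 ∧ ∀ u, G.augIncMatrix s u (some s(v, w)) =
      ε * ((if u = v then 1 else 0) - (if u = w then 1 else 0)) := by
  have hout : s((s(v, w) : Sym2 V).out.1, (s(v, w) : Sym2 V).out.2) = s(v, w) :=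
    Quot.out_eq (s(v, w) : Sym2 V)
  rcases Sym2.eq_iff.1 hout with ⟨h1, h2⟩ | ⟨h1, h2⟩
  · refine ⟨1, by norm_num, fun u => ?_⟩
    simp only [augIncMatrix, mem_edgeSet, h, if_true, h1, h2, one_mul]
  · refine ⟨-1, by norm_num, fun u => ?_⟩
    simp only [augIncMatrix, mem_edgeSet, h, if_true, h1, h2, neg_mul, one_mul, neg_sub]

/-- The squared determinant of the columns given by a parent function on a rooted forest. -/
theorem sq_det_augIncMatrix_parent [Fintype V] [DecidableEq V] (G : SimpleGraph V) (s : ℝ)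
    (r : V) (p : V → V) (d : V → ℕ) (hadj : ∀ v, v ≠ r → G.Adj v (p v))
    (hd : ∀ v, v ≠ r → d (p v) < d v) :
    ((G.augIncMatrix s).submatrix id
      (fun v => if v = r then none else some s(v, p v))).det ^ 2 =
      s ^ 2 * (Fintype.card V : ℝ) ^ 2 := by
  have hε : ∀ v, ∃ ε : ℝ, ε ^ 2 = 1 ∧ ∀ u,
      G.augIncMatrix s u (if v = r then none else some s(v, p v)) =
        ε * (if v = r then s else (if u = v then 1 else 0) - (if u = p v then 1 else 0)) := by
    intro v
    by_cases hv : v = r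
    · exact ⟨1, by norm_num, fun u => by simp [hv, augIncMatrix]⟩
    · obtain ⟨ε, h1, h2⟩ := G.exists_sign_augIncMatrix s (hadj v hv)
      exact ⟨ε, h1, fun u => by simp only [hv, if_false, h2]⟩
  choose ε hε1 hε2 using hε
  set B : Matrix V V ℝ := fun u v =>
    if v = r then s else (if u = v then 1 else 0) - (if u = p v then 1 else 0) with hB
  have hM : (G.augIncMatrix s).submatrix id
      (fun v => if v = r then none else some s(v, p v)) = of fun u v => ε v * B u v := by
    ext u v
    exact hε2 v u
  have hrow : ∀ v, (∑ u, (1 : ℝ) • B u) v = if v = r then Fintype.card V * s else 0 := by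
    intro v
    by_cases hv : v = r <;> simp [hB, hv, Finset.sum_apply]
  have hdetB : B.det = Fintype.card V * s := by
    have h1 := Matrix.det_updateRow_sum B r (fun _ => 1)
    rw [one_smul] at h1
    rw [← h1, Matrix.det_eq_prod_diag_of_height _
      (fun v => if v = r then ∑ w, d w + 1 else d v), ← Finset.mul_prod_erase _ _ (mem_univ r)]
    · rw [Finset.prod_eq_one, mul_one, Matrix.updateRow_self, hrow, if_pos rfl]
      intro v hv
      have hv' := Finset.ne_of_mem_erase hv
      have hp : v ≠ p v := fun h => (hd v hv').ne (by rw [← h])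
      rw [Matrix.updateRow_ne hv']
      simp [hB, hv', hp]
    · intro i j hij hle
      by_cases hi : i = r
      · subst hi
        rw [Matrix.updateRow_self, hrow, if_neg hij.symm]
      · rw [Matrix.updateRow_ne hi]
        by_cases hj : j = r
        · exfalso
          have := Finset.single_le_sum (f := d) (fun _ _ => Nat.zero_le _) (mem_univ i)
          simp only [hj, hi, if_true, if_false] at hle
          omega
        · simp only [hi, hj, if_false] at hle
          have hp : i ≠ p j := fun h => by
            have := hd j hj
            rw [← h] at this
            omega
          simp [hB, hj, hij, hp]
  rw [hM, Matrix.det_mul_row, hdetB, mul_pow, ← Finset.prod_pow]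
  simp only [hε1, Finset.prod_const_one]
  ring

/-- Every spanning tree is the image of a column selection with known squared determinant. -/
theorem IsTree.exists_columns [Fintype V] [DecidableEq V] {G T : SimpleGraph V} (hT : T.IsTree)
    (hTG : T ≤ G) (s : ℝ) :
    ∃ f : V → Option (Sym2 V), Function.Injective f ∧
      (∀ e, some e ∈ Set.range f ↔ e ∈ T.edgeSet) ∧
      ((G.augIncMatrix s).submatrix id f).det ^ 2 = s ^ 2 * (Fintype.card V : ℝ) ^ 2 := by
  classical
  obtain ⟨r⟩ := hT.connected.nonempty
  have hex : ∀ v, ∃ w, v ≠ r → T.Adj v w ∧ T.dist r w < T.dist r v := fun v => by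
    by_cases hv : v = r
    · exact ⟨v, fun h => absurd hv h⟩
    · obtain ⟨w, hw⟩ := hT.connected.exists_adj_dist_lt r hv
      exact ⟨w, fun _ => hw⟩
  choose p hp using hex
  set f : V → Option (Sym2 V) := fun v => if v = r then none else some s(v, p v) with hf
  have hinj : Function.Injective f := by
    intro v w hvw
    by_cases hv : v = r <;> by_cases hw : w = r
    · rw [hv, hw]
    · simp [hf, hv, hw] at hvw
    · simp [hf, hv, hw] at hvw
    · simp only [hf, hv, hw, if_false, Option.some.injEq] at hvw
      rcases Sym2.eq_iff.1 hvw with h | ⟨h1, h2⟩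
      · exact h.1
      · have h3 := (hp v hv).2
        have h4 := (hp w hw).2
        rw [h2] at h3
        rw [← h1] at h4
        omega
  have hsub : univ.image f ⊆ Finset.insertNone T.edgeFinset := by
    intro k hk
    obtain ⟨v, -, rfl⟩ := Finset.mem_image.1 hk
    by_cases hv : v = r
    · simp [hf, hv]
    · simp [hf, hv, (hp v hv).1]
  have heq : univ.image f = Finset.insertNone T.edgeFinset := by
    refine Finset.eq_of_subset_of_card_le hsub ?_
    rw [Finset.card_image_of_injective _ hinj, Finset.card_insertNone, hT.card_edgeFinset,
      Finset.card_univ]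
  refine ⟨f, hinj, fun e => ?_, G.sq_det_augIncMatrix_parent s r p (T.dist r)
    (fun v hv => hTG (hp v hv).1) (fun v hv => (hp v hv).2)⟩
  have := Finset.ext_iff.1 heq (some e)
  simpa using this

theorem trace_augIncMatrix_mul_transpose [Fintype V] [DecidableEq V] (G : SimpleGraph V)
    (s : ℝ) : (G.augIncMatrix s * (G.augIncMatrix s)ᵀ).trace =
      Fintype.card V * s ^ 2 + 2 * G.edgeSet.ncard := by
  classical
  have hcol : ∀ e : Sym2 V, ∑ u, G.augIncMatrix s u (some e) ^ 2 =
      if e ∈ G.edgeSet then 2 else 0 := by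
    intro e
    induction e with
    | _ v w =>
      by_cases h : G.Adj v w
      · obtain ⟨ε, h1, h2⟩ := G.exists_sign_augIncMatrix s h
        have hne := h.ne
        have hsq : ∀ u, ((if u = v then (1 : ℝ) else 0) - (if u = w then 1 else 0)) ^ 2 =
            (if u = v then 1 else 0) + (if u = w then 1 else 0) := fun u => by
          by_cases hu : u = v <;> by_cases hw : u = w
          · exact absurd (hu.symm.trans hw) hne
          all_goals simp [hu, hw, hne, hne.symm]
        simp only [h2, mul_pow, h1, one_mul, hsq, Finset.sum_add_distrib, Finset.sum_ite_eq',
          mem_univ, if_true, mem_edgeSet, h]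
        norm_num
      · simp [augIncMatrix, h]
  simp only [Matrix.trace, Matrix.diag, Matrix.mul_apply, Matrix.transpose_apply, ← pow_two]
  rw [Finset.sum_comm, Fintype.sum_option]
  simp only [hcol]
  rw [← Finset.sum_filter, Finset.sum_const, Set.ncard_eq_toFinset_card']
  have : Finset.filter (fun e => e ∈ G.edgeSet) univ = G.edgeSet.toFinset := by
    ext; simp
  rw [this]
  simp [augIncMatrix, mul_comm]

/-- The inequality in the matrix-tree theorem, for the Gram matrix of `augIncMatrix`. -/
theorem spanningTreeCount_mul_le_det [Fintype V] [DecidableEq V] (G : SimpleGraph V) (s : ℝ) :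
    (spanningTreeCount G : ℝ) * (s ^ 2 * (Fintype.card V : ℝ) ^ 2) ≤
      (G.augIncMatrix s * (G.augIncMatrix s)ᵀ).det := by
  classical
  let S := {T : SimpleGraph V | T ≤ G ∧ T.IsTree}
  choose f hinj hrange hdet using fun T : S => T.2.2.exists_columns T.2.1 s
  let F : S × Equiv.Perm V → V → Option (Sym2 V) := fun x => f x.1 ∘ x.2
  have hF : Function.Injective F := by
    rintro ⟨T, σ⟩ ⟨T', σ'⟩ h
    have hr : Set.range (f T) = Set.range (f T') := by
      have := congrArg Set.range h
      simpa [F, Set.range_comp] using this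
    have hTT : T = T' := by
      apply Subtype.ext
      apply SimpleGraph.edgeSet_injective
      ext e
      rw [← hrange T, ← hrange T', hr]
    subst hTT
    have : σ = σ' := Equiv.ext fun v => hinj T (congrFun h v)
    rw [this]
  have hFdet : ∀ x, ((G.augIncMatrix s).submatrix id (F x)).det ^ 2 =
      s ^ 2 * (Fintype.card V : ℝ) ^ 2 := by
    rintro ⟨T, σ⟩
    have h2 : (G.augIncMatrix s).submatrix id (F (T, σ)) =
      ((G.augIncMatrix s).submatrix id (f T)).submatrix id σ := rfl
    rw [h2, Matrix.det_permute', mul_pow, hdet, ← Int.cast_pow, ← Units.val_pow_eq_pow_val,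
      Int.units_sq]
    simp
  have hle : ∑ x : S × Equiv.Perm V, ((G.augIncMatrix s).submatrix id (F x)).det ^ 2 ≤
      ∑ g : V → Option (Sym2 V), ((G.augIncMatrix s).submatrix id g).det ^ 2 := by
    rw [← Finset.sum_image (f := fun g => ((G.augIncMatrix s).submatrix id g).det ^ 2)
      hF.injOn]
    exact Finset.sum_le_sum_of_subset_of_nonneg (Finset.subset_univ _)
      fun _ _ _ => sq_nonneg _
  have hcard : spanningTreeCount G = Fintype.card S := by
    rw [← Nat.card_eq_fintype_card]; rfl
  simp only [hFdet, Finset.sum_const, Finset.card_univ, Fintype.card_prod, Fintype.card_perm,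
    nsmul_eq_mul, Matrix.sum_sq_det_submatrix, Nat.cast_mul] at hle
  have hfac : (0 : ℝ) < (Fintype.card V).factorial := by
    exact_mod_cast Nat.factorial_pos _
  rw [hcard]
  refine le_of_mul_le_mul_left ?_ hfac
  linarith

/-- Combination of the matrix-tree inequality with AM–GM. -/
theorem spanningTreeCount_mul_le_pow [Fintype V] [Nonempty V] (G : SimpleGraph V) (s : ℝ) :
    (spanningTreeCount G : ℝ) * (s ^ 2 * (Fintype.card V : ℝ) ^ 2) ≤
      ((Fintype.card V * s ^ 2 + 2 * G.edgeSet.ncard) / Fintype.card V) ^ Fintype.card V := by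
  classical
  refine (G.spanningTreeCount_mul_le_det s).trans ?_
  have hpsd : (G.augIncMatrix s * (G.augIncMatrix s)ᵀ).PosSemidef := by
    simpa using Matrix.posSemidef_self_mul_conjTranspose (G.augIncMatrix s)
  rw [← G.trace_augIncMatrix_mul_transpose s]
  exact hpsd.det_le_trace_div_card_pow

end SimpleGraph

/-- For a finite simple graph `G` on `n ≥ 2` vertices with `m` edges,
`t(G) ≤ n⁻¹ · (2m/(n-1))^(n-1)`. -/
theorem treeCount_le_of_card_edges {n : ℕ} (hn : 2 ≤ n) (G : SimpleGraph (Fin n)) :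
    (spanningTreeCount G : ℝ) ≤
      (n : ℝ)⁻¹ * (2 * (G.edgeSet.ncard : ℝ) / ((n : ℝ) - 1)) ^ (n - 1) := by
  have : Nonempty (Fin n) := ⟨⟨0, by omega⟩⟩
  have hn2 : (2 : ℝ) ≤ n := by exact_mod_cast hn
  have hn0 : (0 : ℝ) < n := by linarith
  have hn1 : (0 : ℝ) < (n : ℝ) - 1 := by linarith
  have key := G.spanningTreeCount_mul_le_pow
  simp only [Fintype.card_fin] at key
  set t : ℝ := (spanningTreeCount G : ℝ) with ht
  set m : ℝ := (G.edgeSet.ncard : ℝ) with hm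
  have hm0 : 0 ≤ m := Nat.cast_nonneg _
  rcases hm0.eq_or_lt with h0 | hpos
  · have h1 := key 1
    rw [← h0] at h1 ⊢
    simp only [one_pow, mul_one, one_mul, mul_zero, add_zero, div_self hn0.ne'] at h1
    have hlt : t < 1 := by
      by_contra! hge
      nlinarith
    have : spanningTreeCount G = 0 := by
      rw [ht, Nat.cast_lt_one] at hlt
      exact hlt
    rw [ht, this, mul_zero, zero_div, zero_pow (by omega)]
    simp
  · set a : ℝ := 2 * m / ((n : ℝ) - 1) with ha
    have ha0 : 0 < a := by positivity
    have h1 := key (Real.sqrt (a / n))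
    rw [Real.sq_sqrt (by positivity)] at h1
    have h2 : ((n : ℝ) * (a / n) + 2 * m) / n = a := by
      rw [ha]
      field_simp
      ring
    have h3 : a ^ n = a ^ (n - 1) * a := by
      rw [← pow_succ, Nat.sub_add_cancel (by omega)]
    have h4 : t * (a / n * (n : ℝ) ^ 2) = (n * t) * a := by
      field_simp
    rw [h2, h3, h4] at h1
    have h5 := le_of_mul_le_mul_right h1 ha0
    rwa [inv_mul_eq_div, le_div_iff₀' hn0]
end

section
/- Let G be a finite simple graph with n vertices and Laplacian characteristic polynomial coefficients c_s(G) defined by P(λ, G) = Σ_{s=0}^{n-1} (−1)^s c_s(G) λ^{n−1−s} (where det(λI − L(G)) = λ·P(λ, G)). Then c_s(G) = Σ{γ(F) : F spanning forest of G with s edges}, where γ(F) is the product of the numbers of vertices of the components of F. -/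
/-- The Laplacian coefficient `c_s(G)`, defined via
`det(λI − L(G)) = λ · P(λ, G)` with `P(λ, G) = Σ_{s} (−1)^s c_s(G) λ^(n−1−s)`;
equivalently `c_s(G) = (−1)^s ·` (coefficient of `λ^(n−s)` in the characteristic
polynomial of `L(G)`). -/
noncomputable def lapCoeff {n : ℕ} (G : SimpleGraph (Fin n)) [DecidableRel G.Adj]
    (s : ℕ) : ℝ :=
  (-1) ^ s * ((G.lapMatrix ℝ).charpoly.coeff (n - s))

/-- `γ(F)`: the product over the connected components of `F` of the number of vertices
of the component (sensible when `F` is a forest). -/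
noncomputable def gammaProd {V : Type*} (F : SimpleGraph V) : ℕ :=
  ∏ᶠ c : F.ConnectedComponent, Nat.card {v : V // F.connectedComponentMk v = c}

theorem Matrix.det_sum_smul_rows {V A : Type*} [Fintype V] [DecidableEq V] [CommRing A]
    (c : V → V → A) (r : V → V → V → A) :
    (Matrix.of fun v => ∑ u, c v u • r v u).det =
      ∑ φ : V → V, (∏ v, c v (φ v)) * (Matrix.of fun v => r v (φ v)).det := by
  have h := (Matrix.detRowAlternating (n := V) (R := A)).toMultilinearMap.map_sum
    (fun v u => c v u • r v u)
  refine h.trans (Finset.sum_congr rfl fun φ _ => ?_)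
  exact (Matrix.detRowAlternating (n := V) (R := A)).toMultilinearMap.map_smul_univ
    (fun v => c v (φ v)) (fun v => r v (φ v))

/-- Every orbit of `φ` reaches a fixed point; such maps encode rooted forests, the fixed points
being the roots and `φ` sending every other vertex to its parent. -/
def EventuallyFixed {V : Type*} (φ : V → V) : Prop :=
  ∀ v, ∃ k, Function.IsFixedPt φ (φ^[k] v)

/-- The graph joining every point to its image under `φ`. -/
def functionalGraph {V : Type*} (φ : V → V) : SimpleGraph V :=
  SimpleGraph.fromRel fun u v => φ u = v

theorem functionalGraph_adj {V : Type*} {φ : V → V} {u v : V} :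
    (functionalGraph φ).Adj u v ↔ u ≠ v ∧ (φ u = v ∨ φ v = u) := by
  simp [functionalGraph]

theorem functionalGraph_le_iff {V : Type*} {φ : V → V} {G : SimpleGraph V} :
    functionalGraph φ ≤ G ↔ ∀ v, φ v = v ∨ G.Adj v (φ v) := by
  constructor
  · intro h v
    by_cases hv : φ v = v
    · exact Or.inl hv
    · exact Or.inr (h (functionalGraph_adj.2 ⟨Ne.symm hv, Or.inl rfl⟩))
  · intro h u v huv
    obtain ⟨hne, rfl | rfl⟩ := functionalGraph_adj.1 huv
    · exact (h u).resolve_left (Ne.symm hne)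
    · exact ((h v).resolve_left hne).symm

namespace EventuallyFixed

variable {V : Type*} {φ : V → V}

open Classical in
/-- The number of steps a point needs to reach a fixed point. -/
noncomputable def height (h : EventuallyFixed φ) (v : V) : ℕ := Nat.find (h v)

/-- The fixed point which a point eventually reaches. -/
noncomputable def root (h : EventuallyFixed φ) (v : V) : V := φ^[h.height v] v

theorem isFixedPt_root (h : EventuallyFixed φ) (v : V) : φ (h.root v) = h.root v := by
  classical exact Nat.find_spec (h v)

theorem height_eq_zero (h : EventuallyFixed φ) {v : V} (hv : φ v = v) : h.height v = 0 := by
  classical exact (Nat.find_eq_zero (h v)).2 hv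

theorem height_apply (h : EventuallyFixed φ) {v : V} (hv : φ v ≠ v) :
    h.height v = h.height (φ v) + 1 := by
  classical exact Nat.find_comp_succ (h v) (h (φ v)) hv

theorem root_eq_self (h : EventuallyFixed φ) {v : V} (hv : φ v = v) : h.root v = v := by
  simp [root, h.height_eq_zero hv]

theorem root_apply (h : EventuallyFixed φ) (v : V) : h.root (φ v) = h.root v := by
  by_cases hv : φ v = v
  · rw [hv]
  · rw [root, root, h.height_apply hv, Function.iterate_succ_apply]

theorem of_height_lt (f : V → ℕ) (hf : ∀ v, φ v ≠ v → f (φ v) < f v) : EventuallyFixed φ := by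
  intro v
  induction hn : f v using Nat.strong_induction_on generalizing v with
  | _ n ih =>
    by_cases hv : φ v = v
    · exact ⟨0, hv⟩
    · obtain ⟨k, hk⟩ := ih _ (hn ▸ hf v hv) (φ v) rfl
      exact ⟨k + 1, hk⟩

theorem eq_of_apply_eq_of_apply_eq (h : EventuallyFixed φ) {u v : V} (huv : φ u = v)
    (hvu : φ v = u) : u = v := by
  by_contra hne
  have h1 := h.height_apply (v := u) (by rw [huv]; exact Ne.symm hne)
  have h2 := h.height_apply (v := v) (by rw [hvu]; exact hne)
  rw [huv] at h1
  rw [hvu] at h2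
  omega

theorem isAcyclic_functionalGraph (h : EventuallyFixed φ) : (functionalGraph φ).IsAcyclic := by
  have key : ∀ v, φ v ≠ v → (functionalGraph φ).IsBridge s(v, φ v) := by
    intro v hv
    rw [SimpleGraph.isBridge_iff]
    rintro ⟨p⟩
    have step : ∀ {a b : V},
        ((functionalGraph φ).deleteEdges {s(v, φ v)}).Walk a b →
          (∃ k, φ^[k] a = v) → ∃ k, φ^[k] b = v := by
      intro a b p
      induction p with
      | nil => exact id
      | @cons a b c hab q ih =>
        rintro ⟨k, hk⟩
        apply ih
        rw [SimpleGraph.deleteEdges_adj, functionalGraph_adj] at hab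
        obtain ⟨⟨hne, rfl | rfl⟩, hdel⟩ := hab
        · cases k with
          | zero => exact absurd (by simp_all) hdel
          | succ k => exact ⟨k, hk⟩
        · exact ⟨k + 1, hk⟩
    obtain ⟨k, hk⟩ := step p ⟨0, rfl⟩
    have hle : ∀ k w, h.height (φ^[k] w) ≤ h.height w := by
      intro k
      induction k with
      | zero => exact fun w => le_rfl
      | succ k ih =>
        intro w
        refine (ih (φ w)).trans ?_
        by_cases hw : φ w = w
        · rw [hw]
        · rw [h.height_apply hw]; omega
    have h1 := hle k (φ v)
    rw [hk, h.height_apply hv] at h1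
    omega
  rw [SimpleGraph.isAcyclic_iff_forall_adj_isBridge]
  intro u v huv
  obtain ⟨hne, rfl | rfl⟩ := functionalGraph_adj.1 huv
  · exact key u (Ne.symm hne)
  · rw [Sym2.eq_swap]
    exact key v hne

theorem ncard_edgeSet_functionalGraph (h : EventuallyFixed φ) :
    (functionalGraph φ).edgeSet.ncard = {v | φ v ≠ v}.ncard := by
  symm
  refine Set.ncard_congr (fun v _ => s(v, φ v)) ?_ ?_ ?_
  · intro v hv
    exact functionalGraph_adj.2 ⟨Ne.symm hv, Or.inl rfl⟩
  · intro u v hu hv huv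
    rw [Sym2.eq_iff] at huv
    obtain ⟨h1, -⟩ | ⟨h1, h2⟩ := huv
    · exact h1
    · exact h.eq_of_apply_eq_of_apply_eq h2 h1.symm
  · intro e
    induction e with
    | _ u v =>
      intro huv
      rw [SimpleGraph.mem_edgeSet, functionalGraph_adj] at huv
      obtain ⟨hne, rfl | rfl⟩ := huv
      · exact ⟨u, Ne.symm hne, rfl⟩
      · exact ⟨v, hne, Sym2.eq_swap⟩

theorem exists_isPath_root (h : EventuallyFixed φ) (v : V) :
    ∃ p : (functionalGraph φ).Walk v (h.root v),
      p.IsPath ∧ p.snd = φ v ∧ ∀ w ∈ p.support, h.height w ≤ h.height v := by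
  induction hn : h.height v using Nat.strong_induction_on generalizing v with
  | _ n ih =>
    by_cases hv : φ v = v
    · rw [h.root_eq_self hv]
      exact ⟨.nil, by simp, hv.symm, by simp [hn]⟩
    · have hlt := h.height_apply hv
      obtain ⟨p, hp, -, hle⟩ := ih _ (by omega) (φ v) rfl
      refine ⟨(SimpleGraph.Walk.cons (functionalGraph_adj.2 ⟨Ne.symm hv, Or.inl rfl⟩) p).copy
        rfl (h.root_apply v), ?_, ?_, ?_⟩
      · rw [SimpleGraph.Walk.isPath_copy]
        refine hp.cons fun hmem => ?_
        have := hle v hmem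
        omega
      · simp [SimpleGraph.Walk.snd]
      · intro w hw
        rw [SimpleGraph.Walk.support_copy, SimpleGraph.Walk.support_cons, List.mem_cons] at hw
        obtain rfl | hw := hw
        · exact hn.le
        · have := hle w hw
          omega

theorem root_eq_of_reachable (h : EventuallyFixed φ) {u v : V}
    (huv : (functionalGraph φ).Reachable u v) : h.root u = h.root v := by
  obtain ⟨p⟩ := huv
  induction p with
  | nil => rfl
  | cons hab _ ih =>
    rw [← ih]
    obtain ⟨-, rfl | rfl⟩ := functionalGraph_adj.1 hab
    · exact (h.root_apply _).symm
    · exact h.root_apply _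

theorem det_one_sub (h : EventuallyFixed φ) [Fintype V] [DecidableEq V] {A : Type*}
    [CommRing A] :
    (Matrix.of fun v : V =>
      (Pi.single v 1 - if φ v = v then 0 else Pi.single (φ v) 1 : V → A)).det = 1 := by
  rw [Matrix.BlockTriangular.det (b := fun v => OrderDual.toDual (h.height v))]
  · refine Finset.prod_eq_one fun a _ => ?_
    refine (congrArg Matrix.det ?_).trans Matrix.det_one
    ext ⟨i, hi⟩ ⟨j, hj⟩
    have hij : φ i ≠ i → j ≠ φ i := by
      rintro hne rfl
      have := h.height_apply hne
      have := OrderDual.toDual.injective (hi.trans hj.symm)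
      omega
    by_cases hf : φ i = i
    · simp [Matrix.toSquareBlock_def, Matrix.one_apply, Pi.single_apply, hf, eq_comm (a := i)]
    · simp [Matrix.toSquareBlock_def, Matrix.one_apply, Pi.single_apply, hf, hij hf,
        eq_comm (a := i)]
  · intro i j hij
    rw [OrderDual.toDual_lt_toDual] at hij
    have hne : j ≠ i := by rintro rfl; exact lt_irrefl _ hij
    by_cases hf : φ i = i
    · simp [hf, hne]
    · have : j ≠ φ i := by
        rintro rfl
        have := h.height_apply hf
        omega
      simp [hf, hne, this]

end EventuallyFixed

theorem det_one_sub_eq_zero_of_not_eventuallyFixed {V : Type*} [Fintype V] [DecidableEq V]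
    {A : Type*} [CommRing A] [IsDomain A] {φ : V → V} (h : ¬ EventuallyFixed φ) :
    (Matrix.of fun v : V =>
      (Pi.single v 1 - if φ v = v then 0 else Pi.single (φ v) 1 : V → A)).det = 0 := by
  classical
  obtain ⟨w, hw⟩ := not_forall.1 h
  refine Matrix.exists_mulVec_eq_zero_iff.1
    ⟨fun v => if ∃ k, Function.IsFixedPt φ (φ^[k] v) then 0 else 1, ?_, ?_⟩
  · intro h0
    simpa [hw] using congrFun h0 w
  · ext v
    have hiff : (∃ k, Function.IsFixedPt φ (φ^[k] v)) ↔
        ∃ k, Function.IsFixedPt φ (φ^[k] (φ v)) := by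
      constructor
      · rintro ⟨k, hk⟩
        refine ⟨k, ?_⟩
        rw [← Function.iterate_succ_apply, Function.iterate_succ_apply', hk]
        exact hk
      · rintro ⟨k, hk⟩
        exact ⟨k + 1, hk⟩
    by_cases hv : φ v = v
    · have : ∃ k, Function.IsFixedPt φ (φ^[k] v) := ⟨0, hv⟩
      simp [Matrix.mulVec, hv, this]
    · have hrow : (Matrix.of fun v : V => (Pi.single v 1 -
          if φ v = v then 0 else Pi.single (φ v) 1 : V → A)) v =
            Pi.single v 1 - Pi.single (φ v) 1 := by
        exact congrArg ((Pi.single v 1 : V → A) - ·) (if_neg hv)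
      rw [Matrix.mulVec, hrow, sub_dotProduct, single_one_dotProduct, single_one_dotProduct,
        Pi.zero_apply, sub_eq_zero]
      exact if_congr hiff rfl rfl

namespace SimpleGraph

variable {V : Type*} (F : SimpleGraph V)

/-- The map sending every vertex to the next vertex on a path to the root of its component. -/
noncomputable def parent (r : ∀ c : F.ConnectedComponent, {v // F.connectedComponentMk v = c})
    (v : V) : V := by
  classical exact (ConnectedComponent.exact (r (F.connectedComponentMk v)).2.symm).some.toPath.1.snd

variable {F} {r : ∀ c : F.ConnectedComponent, {v // F.connectedComponentMk v = c}}

theorem IsAcyclic.parent_eq (hF : F.IsAcyclic) {v w : V}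
    (hw : (r (F.connectedComponentMk v)).1 = w) (p : F.Walk v w) (hp : p.IsPath) :
    F.parent r v = p.snd := by
  classical
  subst hw
  exact congrArg (fun q : F.Path _ _ => q.1.snd) ((hF.subsingleton_path _ _).elim _ ⟨p, hp⟩)

theorem exists_isPath_parent (r : ∀ c : F.ConnectedComponent, {v // F.connectedComponentMk v = c})
    (v : V) : ∃ p : F.Walk v (r (F.connectedComponentMk v)).1, p.IsPath ∧ F.parent r v = p.snd := by
  classical
  exact ⟨_, (ConnectedComponent.exact (r (F.connectedComponentMk v)).2.symm).some.toPath.2, rfl⟩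

theorem adj_parent {v : V} (hv : (r (F.connectedComponentMk v)).1 ≠ v) :
    F.Adj v (F.parent r v) := by
  obtain ⟨p, -, h⟩ := exists_isPath_parent r v
  rw [h]
  exact p.adj_snd (SimpleGraph.Walk.not_nil_of_ne hv.symm)

theorem IsAcyclic.parent_eq_self_iff (hF : F.IsAcyclic) {v : V} :
    F.parent r v = v ↔ (r (F.connectedComponentMk v)).1 = v := by
  constructor
  · intro h
    by_contra hv
    exact (adj_parent hv).ne h.symm
  · intro h
    exact hF.parent_eq h .nil .nil

theorem IsAcyclic.parent_eq_or_parent_eq (hF : F.IsAcyclic) {u v : V} (huv : F.Adj u v) :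
    F.parent r u = v ∨ F.parent r v = u := by
  obtain ⟨p, hp, h⟩ := exists_isPath_parent r u
  by_cases hv : v ∈ p.support
  · left
    rw [h]
    exact (hF.eq_snd_of_adj_start hp huv hv).symm
  · right
    have hr : (r (F.connectedComponentMk v)).1 = (r (F.connectedComponentMk u)).1 := by
      rw [ConnectedComponent.sound huv.symm.reachable]
    simpa using hF.parent_eq hr (.cons huv.symm p) (hp.cons hv)

theorem IsAcyclic.eventuallyFixed_parent (hF : F.IsAcyclic) :
    EventuallyFixed (F.parent r) := by
  refine .of_height_lt (fun v => F.dist v (r (F.connectedComponentMk v)).1) fun v hv => ?_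
  have hv' := mt hF.parent_eq_self_iff.2 hv
  have hreach := ConnectedComponent.exact (r (F.connectedComponentMk v)).2.symm
  obtain ⟨p, hp, hlen⟩ := hreach.exists_path_of_dist
  have hnil : ¬ p.Nil := Walk.not_nil_of_ne (Ne.symm hv')
  have hpar := hF.parent_eq rfl p hp
  have hcomp : F.connectedComponentMk (F.parent r v) = F.connectedComponentMk v :=
    ConnectedComponent.sound (adj_parent hv').symm.reachable
  have htail := p.length_tail_add_one hnil
  have hdist := dist_le p.tail
  rw [hcomp, hpar]
  omega

theorem IsAcyclic.functionalGraph_parent (hF : F.IsAcyclic) :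
    functionalGraph (F.parent r) = F := by
  refine le_antisymm (functionalGraph_le_iff.2 fun v => ?_) fun u v huv =>
    functionalGraph_adj.2 ⟨huv.ne, hF.parent_eq_or_parent_eq huv⟩
  rw [hF.parent_eq_self_iff]
  exact or_iff_not_imp_left.2 adj_parent

theorem IsAcyclic.parent_injective (hF : F.IsAcyclic) : Function.Injective F.parent := by
  intro r r' h
  funext c
  have h1 : F.parent r (r c).1 = (r c).1 := hF.parent_eq_self_iff.2 (by rw [(r c).2])
  rw [h, hF.parent_eq_self_iff, (r c).2] at h1
  exact Subtype.ext h1.symm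

theorem exists_parent_eq {φ : V → V} (h : EventuallyFixed φ) :
    ∃ r, (functionalGraph φ).parent r = φ := by
  have hroot (v : V) : (functionalGraph φ).Reachable v (h.root v) :=
    let ⟨p, _⟩ := h.exists_isPath_root v
    ⟨p⟩
  refine ⟨fun c => ⟨h.root c.out, ?_⟩, ?_⟩
  · exact (ConnectedComponent.sound (hroot c.out)).symm.trans (Quot.out_eq c)
  · funext v
    obtain ⟨p, hp, hsnd, -⟩ := h.exists_isPath_root v
    refine (h.isAcyclic_functionalGraph.parent_eq ?_ p hp).trans hsnd
    exact h.root_eq_of_reachable (ConnectedComponent.exact (Quot.out_eq _))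

theorem IsAcyclic.card_eventuallyFixed [Finite V] (hF : F.IsAcyclic) :
    Nat.card {φ : V → V // EventuallyFixed φ ∧ functionalGraph φ = F} = gammaProd F := by
  classical
  have := Fintype.ofFinite F.ConnectedComponent
  rw [gammaProd, finprod_eq_prod_of_fintype, ← Nat.card_pi]
  refine (Nat.card_congr (Equiv.ofBijective
    (fun r => ⟨F.parent r, hF.eventuallyFixed_parent, hF.functionalGraph_parent⟩) ⟨?_, ?_⟩)).symm
  · intro r r' h
    exact hF.parent_injective (congrArg Subtype.val h)
  · rintro ⟨φ, h, rfl⟩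
    obtain ⟨r, hr⟩ := exists_parent_eq h
    exact ⟨r, Subtype.ext hr⟩

open Polynomial in
open Classical in
theorem charpoly_lapMatrix [Fintype V] [DecidableEq V] {R : Type*} [CommRing R] [IsDomain R]
    (G : SimpleGraph V) [DecidableRel G.Adj] :
    (G.lapMatrix R).charpoly =
      ∑ φ : V → V with EventuallyFixed φ ∧ functionalGraph φ ≤ G,
        X ^ (Fintype.card V - {v | φ v ≠ v}.ncard) * (-1) ^ {v | φ v ≠ v}.ncard := by
  have hrows : (G.lapMatrix R).charmatrix = Matrix.of fun v => ∑ u,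
      (if u = v then X else if G.Adj v u then -1 else 0 : R[X]) •
        (Pi.single v 1 - if u = v then 0 else Pi.single u 1 : V → R[X]) := by
    ext1 v w
    rw [Matrix.of_apply, Finset.sum_apply]
    by_cases hvw : w = v
    · subst hvw
      have hterm (u : V) : ((if u = w then X else if G.Adj w u then -1 else 0 : R[X]) •
          (Pi.single w 1 - if u = w then 0 else Pi.single u 1 : V → R[X])) w =
          (if u = w then X else 0) - if G.Adj w u then 1 else 0 := by
        by_cases hu : u = w
        · simp [hu]
        · by_cases huw : G.Adj w u <;> simp [hu, huw, Ne.symm hu]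
      simp_rw [hterm]
      simp [lapMatrix, degMatrix, ← card_neighborFinset_eq_degree,
        neighborFinset_eq_filter]
    · have hterm (u : V) : ((if u = v then X else if G.Adj v u then -1 else 0 : R[X]) •
          (Pi.single v 1 - if u = v then 0 else Pi.single u 1 : V → R[X])) w =
          if w = u then if G.Adj v u then 1 else 0 else 0 := by
        by_cases hu : u = v
        · subst hu
          simp [hvw]
        · by_cases huw : w = u
          · subst huw
            by_cases hadj : G.Adj v w <;> simp [hu, hadj]
          · simp [hu, huw, hvw]
      simp_rw [hterm]
      by_cases hadj : G.Adj v w <;>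
        simp [lapMatrix, degMatrix, hadj, Ne.symm hvw]
  rw [Matrix.charpoly, hrows, Matrix.det_sum_smul_rows, Finset.sum_filter]
  refine Finset.sum_congr rfl fun φ _ => ?_
  by_cases h : EventuallyFixed φ
  · rw [h.det_one_sub, mul_one]
    by_cases hG : functionalGraph φ ≤ G
    · rw [if_pos ⟨h, hG⟩]
      rw [functionalGraph_le_iff] at hG
      have hc (v : V) : (if φ v = v then X else if G.Adj v (φ v) then -1 else 0 : R[X]) =
          if φ v = v then X else -1 := by
        split_ifs with h1 h2
        · rfl
        · rfl
        · exact absurd (hG v) (by simp [h1, h2])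
      simp_rw [hc]
      rw [Finset.prod_ite, Finset.prod_const, Finset.prod_const]
      have h1 : {v | φ v ≠ v}.ncard = (Finset.univ.filter fun v => ¬ φ v = v).card := by
        rw [← Set.ncard_coe_finset]
        simp
      have h2 := Finset.card_filter_add_card_filter_not (s := Finset.univ) (fun v => φ v = v)
      rw [Finset.card_univ] at h2
      rw [h1, ← h2, Nat.add_sub_cancel]
    · rw [if_neg fun h' => hG h'.2]
      rw [functionalGraph_le_iff] at hG
      push Not at hG
      obtain ⟨v, hv, hadj⟩ := hG
      exact Finset.prod_eq_zero (Finset.mem_univ v) (by simp [hv, hadj])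
  · rw [det_one_sub_eq_zero_of_not_eventuallyFixed h, mul_zero, if_neg fun h' => h h'.1]

end SimpleGraph

open Classical in
theorem lapCoeff_eq_card {n : ℕ} (G : SimpleGraph (Fin n)) [DecidableRel G.Adj]
    (s : ℕ) (hs : s < n) :
    lapCoeff G s = (Finset.univ.filter fun φ : Fin n → Fin n =>
      (EventuallyFixed φ ∧ functionalGraph φ ≤ G) ∧ {v | φ v ≠ v}.ncard = s).card := by
  rw [lapCoeff, G.charpoly_lapMatrix, Polynomial.finsetSum_coeff, Finset.mul_sum,
    ← Finset.filter_filter (fun φ => EventuallyFixed φ ∧ functionalGraph φ ≤ G),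
    Finset.card_filter, Nat.cast_sum]
  refine Finset.sum_congr rfl fun φ _ => ?_
  have hle : {v | φ v ≠ v}.ncard ≤ n := by
    simpa using Set.ncard_le_card {v | φ v ≠ v}
  have h1 (k : ℕ) : ((-1) ^ k : Polynomial ℝ) = Polynomial.C ((-1) ^ k) := by simp
  rw [h1, Polynomial.coeff_mul_C, Polynomial.coeff_X_pow, Fintype.card_fin]
  by_cases hk : {v | φ v ≠ v}.ncard = s
  · rw [hk]
    simp [← mul_pow]
  · rw [if_neg (by omega), if_neg hk]
    simp

/-- For a finite simple graph `G` on `n` vertices and `s ∈ {0, …, n−1}`,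
`c_s(G) = Σ { γ(F) : F a spanning forest of G with s edges }`. -/
theorem lapCoeff_eq_sum_forests {n : ℕ} (G : SimpleGraph (Fin n)) [DecidableRel G.Adj]
    (s : ℕ) (hs : s < n) :
    lapCoeff G s =
      ∑ᶠ F ∈ {F : SimpleGraph (Fin n) | F ≤ G ∧ F.IsAcyclic ∧ F.edgeSet.ncard = s},
        (gammaProd F : ℝ) := by
  classical
  have hset : {F : SimpleGraph (Fin n) | F ≤ G ∧ F.IsAcyclic ∧ F.edgeSet.ncard = s} =
      ((Finset.univ.filter fun F : SimpleGraph (Fin n) =>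
        F ≤ G ∧ F.IsAcyclic ∧ F.edgeSet.ncard = s : Finset _) : Set _) := by
    ext; simp
  rw [hset, finsum_mem_coe_finset, lapCoeff_eq_card G s hs,
    Finset.card_eq_sum_card_fiberwise (f := functionalGraph)
      (t := Finset.univ.filter fun F : SimpleGraph (Fin n) =>
        F ≤ G ∧ F.IsAcyclic ∧ F.edgeSet.ncard = s), Nat.cast_sum]
  · refine Finset.sum_congr rfl fun F hF => ?_
    obtain ⟨hFG, hF, hs⟩ := (Finset.mem_filter.1 hF).2
    rw [← hF.card_eventuallyFixed, Nat.card_eq_fintype_card, Fintype.card_subtype,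
      Finset.filter_filter]
    congr 2
    refine Finset.filter_congr fun φ _ => ⟨fun h => ⟨h.1.1.1, h.2⟩, ?_⟩
    rintro ⟨h, rfl⟩
    exact ⟨⟨⟨h, hFG⟩, h.ncard_edgeSet_functionalGraph.symm.trans hs⟩, rfl⟩
  · intro φ hφ
    obtain ⟨⟨h, hG⟩, hs⟩ := (Finset.mem_filter.1 hφ).2
    exact Finset.mem_filter.2 ⟨Finset.mem_univ _, hG, h.isAcyclic_functionalGraph,
      h.ncard_edgeSet_functionalGraph.trans hs⟩
end

section
/- Let G be a regular bipartite graph: specifically, let X, Y be disjoint sets with |X| = |Y| = s, let B be the complete bipartite graph on (X, Y), and let B₁ be an r-regular spanning subgraph of B with B₂ its bipartite complement (so B₂ is (s−r)-regular and B₁ ∪ B₂ = B edge-disjointly). Then the Laplacian eigenvalues, listed in nondecreasing order as λ_1 ≤ ... ≤ λ_{2s−1} (omitting one zero eigenvalue each), satisfy λ_{2s−1}(B₁) + λ_{2s−1}(B₂) = 2s and λ_i(B₁) + λ_{2s−1−i}(B₂) = s for all i ∈ {1, ..., 2s−2}. -/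
namespace BipartiteLap

open Matrix Polynomial Finset

/-- Eigenvalue shift theorem of Brauer: perturbing a matrix by `v wᵀ`, where `v` is an eigenvector for `a`,
replaces one eigenvalue `a` by `a + w ⬝ᵥ v`. -/
theorem charpoly_add_vecMulVec_mul {K n : Type*} [Field K] [Infinite K] [Fintype n]
    [DecidableEq n] [Nonempty n] {M : Matrix n n K} {v : n → K} {a : K}
    (hv : M *ᵥ v = a • v) (w : n → K) :
    (M + vecMulVec v w).charpoly * (X - C a) = M.charpoly * (X - C (a + w ⬝ᵥ v)) := by
  obtain ⟨k, hk⟩ : ∃ k, Fintype.card n = k + 1 :=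
    Nat.exists_eq_succ_of_ne_zero Fintype.card_ne_zero
  refine mul_left_cancel₀ (pow_ne_zero k (X_sub_C_ne_zero a)) (Polynomial.funext fun t => ?_)
  have hmul : (scalar n t - M) * (scalar n (t - a) - vecMulVec v w) =
      (t - a) • (scalar n t - (M + vecMulVec v w)) := by
    have h1 : M * vecMulVec v w = a • vecMulVec v w := by
      rw [mul_vecMulVec, hv, smul_vecMulVec]
    simp only [scalar_apply, ← smul_one_eq_diagonal, sub_mul, mul_sub, h1, smul_mul_assoc, mul_smul_comm, one_mul,
      mul_one]
    module
  have hdet := congrArg det hmul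
  rw [det_mul, det_smul, ← eval_charpoly, ← eval_charpoly, ← eval_charpoly,
    charpoly_vecMulVec, hk] at hdet
  simp only [eval_mul, eval_pow, eval_sub, eval_X, eval_C, eval_smul, smul_eq_mul,
    Nat.add_sub_cancel] at hdet ⊢
  rw [dotProduct_comm w v]
  linear_combination (-1 : K) * hdet

theorem charpoly_scalar_sub {R n : Type*} [CommRing R] [IsDomain R] [Infinite R] [Fintype n]
    [DecidableEq n] {ι : Type*} [Fintype ι] (hι : Fintype.card ι = Fintype.card n)
    {M : Matrix n n R} {μ : ι → R} (h : M.charpoly = ∏ i, (X - C (μ i))) (c : R) :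
    (scalar n c - M).charpoly = ∏ i, (X - C (c - μ i)) := by
  refine Polynomial.funext fun t => ?_
  have hM : scalar n t - (scalar n c - M) = -(scalar n (c - t) - M) := by
    rw [map_sub]; abel
  rw [eval_charpoly, hM, det_neg, ← eval_charpoly, h, ← hι, ← card_univ, ← prod_const]
  simp only [eval_prod, eval_sub, eval_X, eval_C, ← prod_mul_distrib]
  exact prod_congr rfl fun i _ => by ring

/-- A monotone tuple is determined by the polynomial having its entries as roots. -/
theorem eq_of_monotone_of_prod_X_sub_C_eq {n : ℕ} {f g : Fin n → ℝ} (hf : Monotone f)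
    (hg : Monotone g) (h : ∏ i, (X - C (f i)) = ∏ i, (X - C (g i))) : f = g := by
  have hr := congrArg roots h
  have key (f : Fin n → ℝ) : (∏ i, (X - C (f i))).roots = (List.ofFn f : Multiset ℝ) := by
    rw [← roots_multiset_prod_X_sub_C (List.ofFn f : Multiset ℝ), Multiset.map_coe,
      Multiset.prod_coe, List.map_ofFn, List.prod_ofFn]
    rfl
  rw [key, key, Multiset.coe_eq_coe] at hr
  exact List.ofFn_injective (hr.eq_of_sortedLE hf.sortedLE_ofFn hg.sortedLE_ofFn)

theorem add_rev_eq_of_prod_X_sub_C {n : ℕ} {μ ν : Fin (n + 2) → ℝ} (hμ : Monotone μ)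
    (hν : Monotone ν) {c : ℝ}
    (h : (∏ i, (X - C (ν i))) * ((X - C (c - μ 0)) * (X - C (c - μ (Fin.last _)))) =
      (∏ i, (X - C (c - μ i))) * ((X - C (ν 0)) * (X - C (ν (Fin.last _)))))
    (i : Fin n) : μ i.succ.castSucc + ν i.rev.succ.castSucc = c := by
  simp only [Fin.prod_univ_castSucc (n := n + 1), Fin.prod_univ_succ (n := n),
    Fin.castSucc_zero] at h
  have h' : ∏ i : Fin n, (X - C (ν i.succ.castSucc)) =
      ∏ i : Fin n, (X - C (c - μ i.succ.castSucc)) := by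
    refine mul_left_cancel₀ (mul_ne_zero (mul_ne_zero (X_sub_C_ne_zero (c - μ 0))
      (X_sub_C_ne_zero (c - μ (Fin.last _)))) (mul_ne_zero (X_sub_C_ne_zero (ν 0))
      (X_sub_C_ne_zero (ν (Fin.last _))))) ?_
    linear_combination h
  rw [← Equiv.prod_comp Fin.revPerm fun i : Fin n => X - C (c - μ i.succ.castSucc)] at h'
  have hm : Monotone fun i : Fin n => i.succ.castSucc :=
    fun i j hij => Fin.castSucc_le_castSucc_iff.2 (Fin.succ_le_succ_iff.2 hij)
  have := congrFun (eq_of_monotone_of_prod_X_sub_C_eq (hν.comp hm)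
    (g := fun i => c - μ (Fin.revPerm i).succ.castSucc)
    (fun i j hij => sub_le_sub_left (hμ (hm (Fin.rev_le_rev.2 hij))) c) h') i.rev
  simp only [Function.comp_apply, Fin.revPerm_apply, Fin.rev_rev] at this
  linarith

variable {V : Type*} [Fintype V] [DecidableEq V]

theorem eigenvalue_mem_Icc_of_isRegularOfDegree {G : SimpleGraph V} [DecidableRel G.Adj] {r : ℕ}
    (hG : G.IsRegularOfDegree r) {x : ℝ} (hx : (G.lapMatrix ℝ).charpoly.IsRoot x) :
    0 ≤ x ∧ x ≤ 2 * r := by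
  have hx' : Module.End.HasEigenvalue (toLin' (G.lapMatrix ℝ)) x := by
    rwa [Module.End.hasEigenvalue_iff_isRoot_charpoly, charpoly_toLin']
  obtain ⟨k, hk⟩ := eigenvalue_mem_ball hx'
  have hsum : ∑ j ∈ univ.erase k, ‖G.lapMatrix ℝ k j‖ = r := by
    have : ∀ j ∈ univ.erase k, ‖G.lapMatrix ℝ k j‖ = if G.Adj k j then 1 else 0 := by
      intro j hj
      have hkj : k ≠ j := (ne_of_mem_erase hj).symm
      by_cases h : G.Adj k j <;>
        simp [SimpleGraph.lapMatrix, SimpleGraph.degMatrix, hkj, h]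
    rw [sum_congr rfl this, sum_erase _ (by simp), ← SimpleGraph.degree_eq_sum_if_adj,
      hG.degree_eq]
  have hdiag : G.lapMatrix ℝ k k = r := by
    simp [SimpleGraph.lapMatrix, SimpleGraph.degMatrix, hG.degree_eq]
  rw [hsum, hdiag, Metric.mem_closedBall, Real.dist_eq, abs_le] at hk
  constructor <;> linarith

theorem isRoot_charpoly_of_mulVec_eq {K n : Type*} [Field K] [Fintype n] [DecidableEq n]
    {M : Matrix n n K} {v : n → K} {a : K} (hv0 : v ≠ 0) (hv : M *ᵥ v = a • v) :
    M.charpoly.IsRoot a := by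
  rw [← charpoly_toLin', ← Module.End.hasEigenvalue_iff_isRoot_charpoly]
  exact Module.End.hasEigenvalue_of_hasEigenvector
    (Module.End.hasEigenvector_iff.2 ⟨Module.End.mem_eigenspace_iff.2 (by simpa using hv), hv0⟩)

/-- The vector that is `1` on the left part and `-1` on the right part. -/
def signVec (α β : Type*) : α ⊕ β → ℝ := Sum.elim (fun _ => 1) (fun _ => -1)

theorem lapMatrix_mulVec_signVec {α β : Type*} [Fintype α] [Fintype β] [DecidableEq α]
    [DecidableEq β] {G : SimpleGraph (α ⊕ β)} [DecidableRel G.Adj]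
    (hle : G ≤ completeBipartiteGraph α β) {r : ℕ} (hG : G.IsRegularOfDegree r) :
    G.lapMatrix ℝ *ᵥ signVec α β = (2 * r : ℝ) • signVec α β := by
  ext v
  have : ∑ u ∈ G.neighborFinset v, signVec α β u = ∑ u ∈ G.neighborFinset v, -signVec α β v := by
    refine sum_congr rfl fun u hu => ?_
    have := hle ((G.mem_neighborFinset v u).1 hu)
    rcases v with v | v <;> rcases u with u | u <;> simp_all [signVec]
  rw [SimpleGraph.lapMatrix_mulVec_apply, this, sum_const, SimpleGraph.card_neighborFinset_eq_degree,
    hG.degree_eq]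
  simp
  ring

theorem extreme_eigenvalues {s r n : ℕ} [NeZero s] {G : SimpleGraph (Fin s ⊕ Fin s)}
    [DecidableRel G.Adj] (hle : G ≤ completeBipartiteGraph (Fin s) (Fin s))
    (hG : G.IsRegularOfDegree r) {μ : Fin (n + 1) → ℝ} (hμ : Monotone μ)
    (h : (G.lapMatrix ℝ).charpoly = ∏ i, (X - C (μ i))) :
    μ 0 = 0 ∧ μ (Fin.last n) = 2 * r := by
  have hroot (x : ℝ) : (G.lapMatrix ℝ).charpoly.IsRoot x ↔ ∃ i, μ i = x := by
    simp [h, IsRoot.def, eval_prod, prod_eq_zero_iff, sub_eq_zero, eq_comm (a := x)]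
  have hb (i) := eigenvalue_mem_Icc_of_isRegularOfDegree hG ((hroot (μ i)).2 ⟨i, rfl⟩)
  constructor
  · obtain ⟨i, hi⟩ := (hroot 0).1 (isRoot_charpoly_of_mulVec_eq (v := fun _ => 1)
      (fun h => one_ne_zero (congrFun h (Sum.inl 0)))
      (by rw [G.lapMatrix_mulVec_const_eq_zero, zero_smul]))
    exact le_antisymm (hi ▸ hμ (Fin.zero_le i)) (hb 0).1
  · obtain ⟨i, hi⟩ := (hroot (2 * r)).1 (isRoot_charpoly_of_mulVec_eq
      (v := signVec (Fin s) (Fin s)) (fun h => by simpa [signVec] using congrFun h (Sum.inl 0))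
      (lapMatrix_mulVec_signVec hle hG))
    exact le_antisymm (hb _).2 (hi ▸ hμ (Fin.le_last i))

section Complement

variable {s r : ℕ} {G H : SimpleGraph (Fin s ⊕ Fin s)} [DecidableRel G.Adj] [DecidableRel H.Adj]

theorem isRegularOfDegree_sdiff (hle : G ≤ completeBipartiteGraph (Fin s) (Fin s))
    (hG : G.IsRegularOfDegree r) (hH : H = completeBipartiteGraph (Fin s) (Fin s) \ G) :
    H.IsRegularOfDegree (s - r) := by
  classical
  intro v
  have h1 : H.neighborFinset v =
      univ.filter (fun u => (completeBipartiteGraph (Fin s) (Fin s)).Adj v u) \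
        G.neighborFinset v := by
    ext u; subst hH; simp
  have h2 : #(univ.filter fun u => (completeBipartiteGraph (Fin s) (Fin s)).Adj v u) = s := by
    rw [card_filter, Fintype.sum_sum_type]
    rcases v with v | v <;> simp
  rw [← SimpleGraph.card_neighborFinset_eq_degree, h1, card_sdiff_of_subset, h2,
    SimpleGraph.card_neighborFinset_eq_degree, hG.degree_eq]
  intro u hu
  simpa using hle ((G.mem_neighborFinset v u).1 hu)

theorem degree_le (hle : G ≤ completeBipartiteGraph (Fin s) (Fin s)) [NeZero s]
    (hG : G.IsRegularOfDegree r) : r ≤ s := by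
  rw [← hG.degree_eq (Sum.inl 0), ← SimpleGraph.card_neighborFinset_eq_degree]
  calc _ ≤ #(univ.map (Function.Embedding.inr : Fin s ↪ Fin s ⊕ Fin s)) := by
        refine card_le_card fun u hu => ?_
        have := hle ((G.mem_neighborFinset _ u).1 hu)
        rcases u with u | u <;> simp_all
    _ = s := by simp

theorem lapMatrix_sdiff (hle : G ≤ completeBipartiteGraph (Fin s) (Fin s)) [NeZero s]
    (hG : G.IsRegularOfDegree r) (hH : H = completeBipartiteGraph (Fin s) (Fin s) \ G) :
    H.lapMatrix ℝ = scalar _ (s : ℝ) - G.lapMatrix ℝ +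
      vecMulVec (fun _ => 1) (fun _ => (-1 / 2 : ℝ)) +
      vecMulVec (signVec (Fin s) (Fin s)) ((1 / 2 : ℝ) • signVec (Fin s) (Fin s)) := by
  have hr := degree_le hle hG
  have hH' := isRegularOfDegree_sdiff hle hG hH
  ext u v
  have hadj : H.Adj u v ↔ (completeBipartiteGraph (Fin s) (Fin s)).Adj u v ∧ ¬ G.Adj u v := by
    subst hH; simp
  have hle' : G.Adj u v → (completeBipartiteGraph (Fin s) (Fin s)).Adj u v := fun h => hle h
  simp only [SimpleGraph.lapMatrix, SimpleGraph.degMatrix, hG.degree_eq, hH'.degree_eq,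
    Nat.cast_sub hr, Matrix.sub_apply, Matrix.add_apply, SimpleGraph.adjMatrix_apply, hadj, vecMulVec_apply,
    scalar_apply, diagonal_apply, Pi.smul_apply, smul_eq_mul]
  by_cases h : G.Adj u v
  · have := hle' h
    rcases u with u | u <;> rcases v with v | v <;> simp_all [signVec] <;> norm_num
  · rcases u with u | u <;> rcases v with v | v <;> simp [signVec, h] <;>
      split_ifs <;> norm_num <;> simp_all

theorem charpoly_lapMatrix_sdiff (hle : G ≤ completeBipartiteGraph (Fin s) (Fin s)) [NeZero s]
    (hG : G.IsRegularOfDegree r) (hH : H = completeBipartiteGraph (Fin s) (Fin s) \ G) :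
    (H.lapMatrix ℝ).charpoly * ((X - C (s : ℝ)) * (X - C (s - 2 * r : ℝ))) =
      (scalar _ (s : ℝ) - G.lapMatrix ℝ).charpoly * (X * (X - C (2 * (s - r) : ℝ))) := by
  have h1 : (scalar _ (s : ℝ) - G.lapMatrix ℝ) *ᵥ (fun _ => 1) = (s : ℝ) • fun _ => 1 := by
    rw [sub_mulVec, G.lapMatrix_mulVec_const_eq_zero, scalar_apply, ← smul_one_eq_diagonal, smul_mulVec,
      one_mulVec, sub_zero]
  have h2 : (scalar _ (s : ℝ) - G.lapMatrix ℝ + vecMulVec (fun _ => 1) (fun _ => (-1 / 2 : ℝ))) *ᵥ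
      signVec (Fin s) (Fin s) = (s - 2 * r : ℝ) • signVec (Fin s) (Fin s) := by
    have h3 : (fun _ => (-1 / 2 : ℝ)) ⬝ᵥ signVec (Fin s) (Fin s) = 0 := by
      simp [dotProduct, signVec]
    rw [add_mulVec, sub_mulVec, lapMatrix_mulVec_signVec hle hG, scalar_apply, ← smul_one_eq_diagonal, smul_mulVec,
      one_mulVec, vecMulVec_mulVec, h3]
    simp [sub_smul]
  have e1 := charpoly_add_vecMulVec_mul h1 (fun _ => (-1 / 2 : ℝ))
  have e2 := charpoly_add_vecMulVec_mul h2 ((1 / 2 : ℝ) • signVec (Fin s) (Fin s))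
  have d1 : (s : ℝ) + (fun _ => (-1 / 2 : ℝ)) ⬝ᵥ (fun _ : Fin s ⊕ Fin s => (1 : ℝ)) = 0 := by
    simp [dotProduct]; ring
  have d2 : (s - 2 * r : ℝ) + ((1 / 2 : ℝ) • signVec (Fin s) (Fin s)) ⬝ᵥ
      signVec (Fin s) (Fin s) = 2 * (s - r) := by
    simp [dotProduct, signVec]; ring
  rw [d1, C_0, sub_zero] at e1
  rw [d2, ← lapMatrix_sdiff hle hG hH] at e2
  linear_combination (X - C (s : ℝ)) * e2 + (X - C (2 * (s - r) : ℝ)) * e1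

end Complement

end BipartiteLap

/-- Bipartite Laplacian reciprocity: let `B` be the complete bipartite graph on parts
`X`, `Y` of equal size `s`, let `B₁ ≤ B` be an `r`-regular spanning subgraph and
`B₂ = B \ B₁` its bipartite complement. If `μ` and `ν` are the nondecreasing
enumerations (with multiplicity, indexed `0, …, 2s−1`) of the Laplacian eigenvalues of
`B₁` and `B₂` (so that `μ 0 = ν 0 = 0` and the lists with one zero eigenvalue removed
are `μ 1 ≤ … ≤ μ (2s−1)` and `ν 1 ≤ … ≤ ν (2s−1)`), then
`μ (2s−1) + ν (2s−1) = 2s` and `μ i + ν (2s−1−i) = s` for every `i ∈ {1, …, 2s−2}`. -/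
theorem bipartite_lap_reciprocity {s r : ℕ} (hs : 1 ≤ s)
    (B₁ B₂ : SimpleGraph (Fin s ⊕ Fin s))
    [DecidableRel B₁.Adj] [DecidableRel B₂.Adj]
    (h1 : B₁ ≤ completeBipartiteGraph (Fin s) (Fin s))
    (hreg : B₁.IsRegularOfDegree r)
    (h2 : B₂ = completeBipartiteGraph (Fin s) (Fin s) \ B₁)
    (μ ν : Fin (2 * s) → ℝ) (hμ : Monotone μ) (hν : Monotone ν)
    (hchμ : (B₁.lapMatrix ℝ).charpoly = ∏ i, (Polynomial.X - Polynomial.C (μ i)))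
    (hchν : (B₂.lapMatrix ℝ).charpoly = ∏ i, (Polynomial.X - Polynomial.C (ν i))) :
    μ ⟨2 * s - 1, by omega⟩ + ν ⟨2 * s - 1, by omega⟩ = 2 * (s : ℝ) ∧
      ∀ i : Fin (2 * s), 1 ≤ (i : ℕ) → (i : ℕ) ≤ 2 * s - 2 →
        μ i + ν ⟨2 * s - 1 - (i : ℕ), by omega⟩ = (s : ℝ) := by
  obtain ⟨m, rfl⟩ := Nat.exists_eq_add_of_le' hs
  have hr := BipartiteLap.degree_le h1 hreg
  have hle2 : B₂ ≤ completeBipartiteGraph (Fin (m + 1)) (Fin (m + 1)) := h2 ▸ sdiff_le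
  have hreg2 := BipartiteLap.isRegularOfDegree_sdiff h1 hreg h2
  obtain ⟨hμ0, hμl⟩ := BipartiteLap.extreme_eigenvalues (n := 2 * m + 1) h1 hreg hμ hchμ
  obtain ⟨hν0, hνl⟩ := BipartiteLap.extreme_eigenvalues (n := 2 * m + 1) hle2 hreg2 hν hchν
  rw [Nat.cast_sub hr] at hνl
  have hchar := BipartiteLap.charpoly_lapMatrix_sdiff h1 hreg h2
  rw [hchν, BipartiteLap.charpoly_scalar_sub (by simp; omega) hchμ] at hchar
  have key := BipartiteLap.add_rev_eq_of_prod_X_sub_C (n := 2 * m) (c := ((m + 1 : ℕ) : ℝ))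
    hμ hν (by rw [hμ0, hμl, hν0, hνl, sub_zero, Polynomial.C_0, sub_zero]; exact hchar)
  refine ⟨?_, fun i hi hi' => ?_⟩
  · change μ (Fin.last (2 * m + 1)) + ν (Fin.last (2 * m + 1)) = _
    rw [hμl, hνl]
    ring
  · have := key ⟨i - 1, by omega⟩
    convert this using 3
    · ext; simp; omega
    · ext; simp; omega
end

section
/- For a tree T on n vertices, the Wiener index W(T) = Σ_{{x,y} ⊆ V(T), x ≠ y} d(x,y) equals the Laplacian coefficient c_{n−2}(T), i.e., the (n−2)-nd elementary symmetric polynomial of the nonzero Laplacian eigenvalues λ_1(T), ..., λ_{n−1}(T). -/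
open Matrix Finset

namespace SimpleGraph

variable {V : Type*} {T : SimpleGraph V}

/-- In a tree, every vertex other than `v` has a unique neighbour closer to `v`. -/
theorem IsTree.existsUnique_adj_dist_lt (hT : T.IsTree) {u v : V} (huv : u ≠ v) :
    ∃! w, T.Adj u w ∧ T.dist u v = T.dist w v + 1 := by
  have key (w : V) (h : T.Adj u w ∧ T.dist u v = T.dist w v + 1) :
      ∃ q : T.Walk w v, (Walk.cons h.1 q).IsPath := by
    obtain ⟨q, hq⟩ := hT.connected.exists_walk_length_eq_dist w v
    exact ⟨q, Walk.isPath_of_length_eq_dist _ (by simp [hq, h.2])⟩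
  refine existsUnique_of_exists_of_unique ?_ fun w w' h h' ↦ ?_
  · obtain ⟨p, hp⟩ := hT.connected.exists_walk_length_eq_dist u v
    cases p with
    | nil => exact absurd rfl huv
    | @cons _ w _ h q =>
      refine ⟨w, h, ?_⟩
      have h1 := dist_le q
      have h2 := hT.dist_eq_dist_add_one_of_adj v h
      simp only [Walk.length_cons] at hp
      rw [dist_comm (u := v), dist_comm (u := v)] at h2
      omega
  · obtain ⟨q, hq⟩ := key w h
    obtain ⟨q', hq'⟩ := key w' h'
    have := congrArg (fun p : T.Path u v ↦ p.1.snd)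
      ((hT.isAcyclic.subsingleton_path u v).elim ⟨_, hq⟩ ⟨_, hq'⟩)
    simpa using this

theorem IsTree.even_dist_add_dist_add_dist (hT : T.IsTree) (x u v : V) :
    Even (T.dist x u + T.dist x v + T.dist u v) := by
  obtain ⟨p⟩ := hT.connected.preconnected v u
  induction p with
  | nil => simp
  | @cons a b c h q ih =>
    have h1 := hT.dist_eq_dist_add_one_of_adj x h
    have h2 := hT.dist_eq_dist_add_one_of_adj c h
    grind

/-- The Gromov product of `u` and `v` based at `x`, with respect to the graph distance. -/
noncomputable def gromovProd (T : SimpleGraph V) (x u v : V) : ℤ :=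
  ((T.dist x u : ℤ) + T.dist x v - T.dist u v) / 2

theorem IsTree.two_mul_gromovProd (hT : T.IsTree) (x u v : V) :
    2 * T.gromovProd x u v = T.dist x u + T.dist x v - T.dist u v := by
  have := hT.even_dist_add_dist_add_dist x u v
  unfold gromovProd
  grind

variable [Fintype V] [DecidableEq V] [DecidableRel T.Adj]

/-- The Laplacian of a tree applied to the distance function from `v`. -/
theorem IsTree.lapMatrix_mulVec_dist (hT : T.IsTree) (u v : V) :
    (T.lapMatrix ℤ *ᵥ fun w ↦ (T.dist w v : ℤ)) u = 2 - T.degree u - if u = v then 2 else 0 := by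
  rw [lapMatrix_mulVec_apply]
  split_ifs with huv
  · subst huv
    rw [sum_congr rfl (g := fun _ ↦ (1 : ℤ)) fun w hw ↦ ?_]
    · simp
    · simpa [dist_comm] using (mem_neighborFinset ..).1 hw
  · obtain ⟨w₀, ⟨h₀, hd₀⟩, huniq⟩ := hT.existsUnique_adj_dist_lt huv
    rw [sum_congr rfl (g := fun w ↦ ((T.dist u v : ℤ) + 1) - if w = w₀ then 2 else 0)
      fun w hw ↦ ?_]
    · simp [sum_sub_distrib, h₀]
      ring
    · have hw' : T.Adj u w := (mem_neighborFinset ..).1 hw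
      have h2 := hT.dist_eq_dist_add_one_of_adj v hw'
      rw [dist_comm (u := v), dist_comm (u := v)] at h2
      split_ifs with hww
      · subst hww; omega
      · have : ¬ T.dist u v = T.dist w v + 1 := fun h ↦ hww (huniq w ⟨hw', h⟩)
        omega

theorem IsTree.lapMatrix_mulVec_gromovProd (hT : T.IsTree) {x u : V} (hux : u ≠ x) (v : V) :
    (T.lapMatrix ℤ *ᵥ fun w ↦ T.gromovProd x w v) u = if u = v then 1 else 0 := by
  have h : (2 : ℤ) • (fun w ↦ T.gromovProd x w v) =
      (fun w ↦ (T.dist w x : ℤ)) + (T.dist x v : ℤ) • (fun _ ↦ 1) - fun w ↦ (T.dist w v : ℤ) := by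
    ext w
    simp [hT.two_mul_gromovProd, dist_comm]
  have h2 := congrFun (congrArg (T.lapMatrix ℤ *ᵥ ·) h) u
  simp only [mulVec_smul, mulVec_sub, mulVec_add, lapMatrix_mulVec_const_eq_zero, Pi.add_apply,
    Pi.sub_apply, Pi.smul_apply, hT.lapMatrix_mulVec_dist, if_neg hux] at h2
  split_ifs at h2 ⊢ <;> simp at h2 <;> omega

/-- Grounding the Laplacian of a tree at `x` gives a matrix whose inverse is the matrix of Gromov
products based at `x`, with the column of `x` replaced by ones. -/
theorem IsTree.updateRow_lapMatrix_mul (hT : T.IsTree) (x : V) :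
    (T.lapMatrix ℤ).updateRow x (Pi.single x 1) *
      (Matrix.of (T.gromovProd x)).updateCol x (fun _ ↦ 1) = 1 := by
  rw [updateRow_mul, single_one_vecMul]
  ext u v
  rcases eq_or_ne u x with rfl | hux
  · rcases eq_or_ne v u with rfl | hvu
    · simp
    · have := hT.two_mul_gromovProd u u v
      simp at this
      simp [hvu, hvu.symm, this]
  · rw [updateRow_ne hux]
    rcases eq_or_ne v x with rfl | hvx
    · have := congrFun (T.lapMatrix_mulVec_const_eq_zero (R := ℤ)) u
      simp only [mulVec, dotProduct] at this
      simpa [mul_apply, hux] using this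
    · have := hT.lapMatrix_mulVec_gromovProd hux v
      simp only [mulVec, dotProduct] at this
      simpa [mul_apply, hvx, one_apply] using this

variable (T) in
theorem map_lapMatrix (R : Type*) [Ring R] :
    (T.lapMatrix ℤ).map (Int.cast : ℤ → R) = T.lapMatrix R := by
  ext i j
  simp only [lapMatrix, degMatrix, map_apply, Matrix.sub_apply, diagonal_apply, adjMatrix_apply]
  split_ifs <;> simp

variable (T) in
theorem cast_det_submatrix_lapMatrix (s : Finset V) :
    (((T.lapMatrix ℤ).submatrix (Subtype.val : s → V) (Subtype.val : s → V)).det : ℝ) =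
      ((T.lapMatrix ℝ).submatrix (Subtype.val : s → V) (Subtype.val : s → V)).det := by
  rw [Int.cast_det, ← map_lapMatrix T ℝ]
  rfl

/-- The determinant of the Laplacian of a tree grounded at a vertex is `1`. -/
theorem IsTree.det_updateRow_lapMatrix (hT : T.IsTree) (x : V) :
    ((T.lapMatrix ℤ).updateRow x (Pi.single x 1)).det = 1 := by
  have hnonneg : 0 ≤ ((T.lapMatrix ℤ).updateRow x (Pi.single x 1)).det := by
    have h := ((T.posSemidef_lapMatrix ℝ).submatrix
      (Subtype.val : ({x}ᶜ : Finset V) → V)).det_nonneg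
    rw [← cast_det_submatrix_lapMatrix, ← det_piecewise_one_eq_submatrix_det] at h
    convert! Int.cast_nonneg_iff.1 h
    ext i j
    by_cases hi : i = x <;> simp [hi, updateRow_apply, Finset.piecewise, one_eq_pi_single]
  have h := congrArg det (hT.updateRow_lapMatrix_mul x)
  rw [det_mul, det_one] at h
  exact Int.eq_one_of_mul_eq_one_right hnonneg h

/-- Deleting the rows and columns of `x` and `y` from the Laplacian of a tree leaves a matrix
with determinant the distance from `x` to `y`. -/
theorem IsTree.det_submatrix_lapMatrix (hT : T.IsTree) {x y : V} (hxy : x ≠ y) :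
    ((T.lapMatrix ℤ).submatrix (Subtype.val : ({x, y}ᶜ : Finset V) → V) Subtype.val).det =
      T.dist x y := by
  have hadj : ((T.lapMatrix ℤ).updateRow x (Pi.single x 1)).adjugate =
      (Matrix.of (T.gromovProd x)).updateCol x (fun _ ↦ 1) := by
    have h := congrArg (((T.lapMatrix ℤ).updateRow x (Pi.single x 1)).adjugate * ·)
      (hT.updateRow_lapMatrix_mul x)
    simpa [← Matrix.mul_assoc, adjugate_mul, hT.det_updateRow_lapMatrix] using h.symm
  have h := congrFun (congrFun hadj y) y
  rw [adjugate_apply, updateCol_ne hxy.symm, of_apply] at h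
  have hg := hT.two_mul_gromovProd x y y
  rw [dist_self] at hg
  rw [← det_piecewise_one_eq_submatrix_det, show (T.dist x y : ℤ) = T.gromovProd x y y by omega,
    ← h]
  congr 1
  ext i j
  by_cases hi : i = x <;> by_cases hi' : i = y <;>
    simp_all [updateRow_apply, Finset.piecewise, one_eq_pi_single]

end SimpleGraph

theorem Finset.sum_offDiag_eq_two_mul_sum_powersetCard {V R : Type*} [Fintype V] [DecidableEq V]
    [CommSemiring R] (h2 : 2 ≤ Fintype.card V) (f : V → V → R) (g : Finset V → R)
    (hfg : ∀ x y, x ≠ y → f x y = g {x, y}ᶜ) :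
    ∑ p ∈ (univ : Finset V).offDiag, f p.1 p.2 =
      2 * ∑ s ∈ univ.powersetCard (Fintype.card V - 2), g s := by
  rw [← sum_fiberwise_of_maps_to (g := fun p : V × V ↦ ({p.1, p.2}ᶜ : Finset V))
    (t := univ.powersetCard (Fintype.card V - 2)), mul_sum]
  · refine sum_congr rfl fun s hs ↦ ?_
    have hs' : sᶜ.card = 2 := by
      rw [card_compl, (mem_powersetCard.1 hs).2]
      omega
    obtain ⟨x, y, hxy, hsxy⟩ := card_eq_two.1 hs'
    have hfil : {p ∈ (univ : Finset V).offDiag | ({p.1, p.2}ᶜ : Finset V) = s} =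
        {(x, y), (y, x)} := by
      ext ⟨a, b⟩
      rw [mem_filter, compl_eq_comm, hsxy, ← Finset.coe_inj, coe_pair, coe_pair,
        Set.pair_eq_pair_iff]
      simp only [mem_offDiag, mem_univ, true_and, mem_insert, mem_singleton, Prod.mk.injEq]
      grind
    have hs2 : s = {x, y}ᶜ := by rw [← hsxy, compl_compl]
    rw [hfil, sum_pair (by simp [hxy]), hfg x y hxy, hfg y x hxy.symm, pair_comm y x, hs2, two_mul]
  · rintro ⟨a, b⟩ hab
    rw [mem_offDiag] at hab
    exact mem_powersetCard.2 ⟨subset_univ _, by rw [card_compl, card_pair hab.2.2]⟩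

/-- For a tree `T` on `n` vertices, the Wiener index
`W(T) = Σ_{{x,y} ⊆ V(T), x ≠ y} d(x, y)` (here written as half the sum over ordered
pairs of distinct vertices of the graph distance) equals the Laplacian coefficient
`c_{n−2}(T)`. -/
theorem wiener_index_eq_lapCoeff {n : ℕ} (hn : 2 ≤ n) (T : SimpleGraph (Fin n))
    [DecidableRel T.Adj] (hT : T.IsTree) :
    lapCoeff T (n - 2) =
      (1 / 2) * ∑ p ∈ Finset.univ.offDiag, (T.dist p.1 p.2 : ℝ) := by
  have hc := (T.lapMatrix ℝ).charpoly_coeff_eq_sum_minors (n - 2) (by simp)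
  rw [Fintype.card_fin] at hc
  rw [lapCoeff, hc, ← mul_assoc, ← pow_add, Even.neg_one_pow ⟨_, rfl⟩, one_mul,
    Finset.sum_offDiag_eq_two_mul_sum_powersetCard (by simpa using hn)
      (fun x y ↦ (T.dist x y : ℝ))
      (fun s ↦ ((T.lapMatrix ℝ).submatrix (Subtype.val : s → Fin n) Subtype.val).det)]
  · rw [Fintype.card_fin]
    ring
  · intro x y hxy
    rw [← SimpleGraph.cast_det_submatrix_lapMatrix, hT.det_submatrix_lapMatrix hxy]
    simp
end
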